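/- Let n ≥ 1, w ∈ L^1_loc(ℝ^n), δ > 0, and let P ∈ Q_{2δ} be a cube of side 2δ of the mesh Q_{2δ}. Let N_δ(P) denote the family of unordered pairs {Q, Q'} of distinct cubes Q, Q' ∈ Q_δ contained in P that share an (n−1)-dimensional face. Then Σ_{{Q,Q'}∈N_δ(P)} |w_Q − w_{Q'}| ≤ n·2^n · ⨍_P |w(x) − ⨍_P w| dx, where w_Q := ⨍_Q w. Consequently |Dw^δ|(P) = δ^{n−1} Σ_{{Q,Q'}∈N_δ(P)} |w_Q − w_{Q'}| ≤ 2n·(2δ)^{n−1}·⨍_P |w(x) − ⨍_P w| dx. -/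

import Mathlib

open MeasureTheory Filter Topology ENNReal

noncomputable section

/-- The standard open cube `(0, ε)^n` in `ℝ^n`. -/
def stdCube (n : ℕ) (ε : ℝ) : Set (EuclideanSpace ℝ (Fin n)) :=
  {x | ∀ i, x i ∈ Set.Ioo (0 : ℝ) ε}

/-- `Q ⊆ ℝ^n` is an `ε`-cube: the image of `(0,ε)^n` under a rigid motion of `ℝ^n`. -/
def IsCube (n : ℕ) (ε : ℝ) (Q : Set (EuclideanSpace ℝ (Fin n))) : Prop :=
  ∃ T : EuclideanSpace ℝ (Fin n) ≃ᵢ EuclideanSpace ℝ (Fin n), Q = T '' stdCube n ε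

/-- The BMO-type energy `K_ε(f)`: the supremum, over all countable families `H` of pairwise
disjoint `ε`-cubes, of `ε^(n-1) * Σ_{Q ∈ H} ⨍_Q |f - ⨍_Q f|`, valued in `[0,∞]`. -/
def K (n : ℕ) (ε : ℝ) (f : EuclideanSpace ℝ (Fin n) → ℝ) : ℝ≥0∞ :=
  ⨆ (H : Set (Set (EuclideanSpace ℝ (Fin n)))) (_ : H.Countable)
    (_ : ∀ Q ∈ H, IsCube n ε Q) (_ : H.Pairwise Disjoint),
    ENNReal.ofReal (ε ^ (n - 1)) *
      ∑' Q : H, ENNReal.ofReal (⨍ x in (Q : Set (EuclideanSpace ℝ (Fin n))),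
        |f x - ⨍ y in (Q : Set (EuclideanSpace ℝ (Fin n))), f y|)

/-- The divergence of a vector field `φ : ℝ^n → ℝ^n`. -/
def div' {n : ℕ} (φ : EuclideanSpace ℝ (Fin n) → EuclideanSpace ℝ (Fin n))
    (x : EuclideanSpace ℝ (Fin n)) : ℝ :=
  ∑ i, fderiv ℝ φ x (EuclideanSpace.single i 1) i

/-- The extended total variation `|Df|(ℝ^n)`, valued in `[0,∞]`. -/
def totalVariation (n : ℕ) (f : EuclideanSpace ℝ (Fin n) → ℝ) : ℝ≥0∞ :=
  ⨆ (φ : EuclideanSpace ℝ (Fin n) → EuclideanSpace ℝ (Fin n)) (_ : ContDiff ℝ 1 φ)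
    (_ : HasCompactSupport φ) (_ : ∀ x, ‖φ x‖ ≤ 1),
    ENNReal.ofReal (∫ x, f x * div' φ x)

/-- The mesh `Q_δ` of open `δ`-cubes with edges parallel to the coordinate axes: the cube
indexed by `z ∈ ℤ^n` is `(0,δ)^n + δz`. -/
def meshCube (n : ℕ) (δ : ℝ) (z : Fin n → ℤ) : Set (EuclideanSpace ℝ (Fin n)) :=
  {x | ∀ i, x i ∈ Set.Ioo (δ * (z i : ℝ)) (δ * ((z i : ℝ) + 1))}

/-- The piecewise constant `δ`-approximation `w^δ` of `w` on the mesh `Q_δ`, equal on each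
cube of the mesh to the average of `w` over that cube. -/
def pcn (n : ℕ) (δ : ℝ) (w : EuclideanSpace ℝ (Fin n) → ℝ)
    (x : EuclideanSpace ℝ (Fin n)) : ℝ :=
  ⨍ y in meshCube n δ (fun i => ⌈x i / δ⌉ - 1), w y

/-- The cube `D_R = (-R, R)^n`. -/
def DCube (n : ℕ) (R : ℝ) : Set (EuclideanSpace ℝ (Fin n)) :=
  {x | ∀ i, x i ∈ Set.Ioo (-R) R}

/-- The total variation `|Df|(U)` of `f` on an open set `U`, valued in `[0,∞]`. -/
def totalVariationOn (n : ℕ) (f : EuclideanSpace ℝ (Fin n) → ℝ)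
    (U : Set (EuclideanSpace ℝ (Fin n))) : ℝ≥0∞ :=
  ⨆ (φ : EuclideanSpace ℝ (Fin n) → EuclideanSpace ℝ (Fin n)) (_ : ContDiff ℝ 1 φ)
    (_ : HasCompactSupport φ) (_ : tsupport φ ⊆ U) (_ : ∀ x, ‖φ x‖ ≤ 1),
    ENNReal.ofReal (∫ x, f x * div' φ x)

/-- The index of the subcube of `meshCube n (2 * δ) z` selected by `σ`. -/
abbrev childIndex {n : ℕ} (z : Fin n → ℤ) (σ : Fin n → Fin 2) : Fin n → ℤ :=
  fun j => 2 * z j + ((σ j : ℕ) : ℤ)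

theorem meshCube_eq_preimage (n : ℕ) (δ : ℝ) (z : Fin n → ℤ) :
    meshCube n δ z = WithLp.ofLp ⁻¹'
      Set.univ.pi fun i => Set.Ioo (δ * (z i : ℝ)) (δ * ((z i : ℝ) + 1)) := by
  ext x; simp [meshCube]

theorem isOpen_meshCube (n : ℕ) (δ : ℝ) (z : Fin n → ℤ) : IsOpen (meshCube n δ z) := by
  rw [meshCube_eq_preimage]
  exact (isOpen_set_pi Set.finite_univ fun _ _ => isOpen_Ioo).preimage
    (PiLp.continuous_ofLp 2 _)

theorem volume_meshCube (n : ℕ) {δ : ℝ} (hδ : 0 < δ) (z : Fin n → ℤ) :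
    volume (meshCube n δ z) = ENNReal.ofReal (δ ^ n) := by
  rw [meshCube_eq_preimage, (PiLp.volume_preserving_ofLp (Fin n)).measure_preimage
    (MeasurableSet.univ_pi fun _ => measurableSet_Ioo).nullMeasurableSet, Real.volume_pi_Ioo]
  simp [mul_add, ENNReal.ofReal_pow hδ.le]

theorem integrableOn_meshCube {n : ℕ} {w : EuclideanSpace ℝ (Fin n) → ℝ}
    (hw : LocallyIntegrable w volume) (δ : ℝ) (z : Fin n → ℤ) :
    IntegrableOn w (meshCube n δ z) := by
  have hK : IsCompact ((WithLp.toLp 2) '' (Set.univ.pi fun i =>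
      Set.Icc (δ * (z i : ℝ)) (δ * ((z i : ℝ) + 1))) : Set (EuclideanSpace ℝ (Fin n))) :=
    (isCompact_univ_pi fun _ => isCompact_Icc).image (PiLp.continuous_toLp 2 _)
  refine (hw.integrableOn_isCompact hK).mono_set fun x hx => ⟨x.ofLp, ?_, rfl⟩
  exact fun i _ => Set.Ioo_subset_Icc_self (hx i)

/-- Two half-open unit-step intervals of the `δ`-mesh sharing a point are equal. -/
theorem mesh_index_unique {δ t : ℝ} (hδ : 0 < δ) {a b : ℤ}
    (ha : t ∈ Set.Ioc (δ * (a : ℝ)) (δ * ((a : ℝ) + 1)))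
    (hb : t ∈ Set.Ioc (δ * (b : ℝ)) (δ * ((b : ℝ) + 1))) : a = b := by
  have h1 : (a : ℝ) < b + 1 := lt_of_mul_lt_mul_left (ha.1.trans_le hb.2) hδ.le
  have h2 : (b : ℝ) < a + 1 := lt_of_mul_lt_mul_left (hb.1.trans_le ha.2) hδ.le
  have h3 : a < b + 1 := by exact_mod_cast h1
  have h4 : b < a + 1 := by exact_mod_cast h2
  omega

theorem disjoint_meshCube {n : ℕ} {δ : ℝ} (hδ : 0 < δ) {a b : Fin n → ℤ} (hab : a ≠ b) :
    Disjoint (meshCube n δ a) (meshCube n δ b) :=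
  Set.disjoint_left.2 fun _ ha hb => hab <| funext fun i =>
    mesh_index_unique hδ (Set.Ioo_subset_Ioc_self (ha i)) (Set.Ioo_subset_Ioc_self (hb i))

theorem childIndex_injective {n : ℕ} (z : Fin n → ℤ) : Function.Injective (childIndex z) := by
  intro σ τ h
  funext j
  have := congrFun h j
  simp only [childIndex] at this
  exact Fin.ext (by omega)

theorem Ioo_child_subset {δ : ℝ} (hδ : 0 < δ) (a : ℤ) (s : Fin 2) :
    Set.Ioo (δ * ((2 * a + ((s : ℕ) : ℤ) : ℤ) : ℝ)) (δ * (((2 * a + ((s : ℕ) : ℤ) : ℤ) : ℝ) + 1)) ⊆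
      Set.Ioo (2 * δ * (a : ℝ)) (2 * δ * ((a : ℝ) + 1)) := by
  have h0 : (0 : ℝ) ≤ (s : ℕ) := Nat.cast_nonneg _
  have h1 : ((s : ℕ) : ℝ) ≤ 1 := by exact_mod_cast Nat.le_of_lt_succ s.isLt
  apply Set.Ioo_subset_Ioo <;> push_cast <;> nlinarith

theorem meshCube_child_subset {n : ℕ} {δ : ℝ} (hδ : 0 < δ) (z : Fin n → ℤ) (σ : Fin n → Fin 2) :
    meshCube n δ (childIndex z σ) ⊆ meshCube n (2 * δ) z :=
  fun _ hx i => Ioo_child_subset hδ (z i) (σ i) (hx i)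

/-- A sum over `{0,1}^n` split into pairs of neighbours in direction `i`. -/
theorem sum_eq_sum_pairs {n : ℕ} (i : Fin n) (h : (Fin n → Fin 2) → ℝ) :
    ∑ σ, h σ = ∑ σ ∈ Finset.univ.filter (fun σ : Fin n → Fin 2 => σ i = 0),
      (h σ + h (Function.update σ i 1)) := by
  rw [Finset.sum_add_distrib, ← Finset.sum_filter_add_sum_filter_not Finset.univ
    (fun σ : Fin n → Fin 2 => σ i = 0)]
  congr 1
  symm
  refine Finset.sum_bij' (fun σ _ => Function.update σ i 1) (fun σ _ => Function.update σ i 0)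
    ?_ ?_ ?_ ?_ ?_
  · simp
  · simp
  · intro σ hσ
    simp only [Finset.mem_filter, Finset.mem_univ, true_and] at hσ
    simp [← hσ]
  · intro σ hσ
    simp only [Finset.mem_filter, Finset.mem_univ, true_and] at hσ
    have : σ i = 1 := by omega
    simp [← this]
  · simp

theorem abs_average_sub_le {n : ℕ} {w : EuclideanSpace ℝ (Fin n) → ℝ}
    (hw : LocallyIntegrable w volume) {δ : ℝ} (hδ : 0 < δ) (z : Fin n → ℤ) (m : ℝ) :
    |(⨍ y in meshCube n δ z, w y) - m| ≤ (δ ^ n)⁻¹ * ∫ y in meshCube n δ z, |w y - m| := by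
  have hvol : volume.real (meshCube n δ z) = δ ^ n := by
    rw [measureReal_def, volume_meshCube n hδ, ENNReal.toReal_ofReal (by positivity)]
  have hfin : volume (meshCube n δ z) ≠ ∞ := by simp [volume_meshCube n hδ]
  have hd : (δ ^ n) ≠ 0 := by positivity
  have hm : (⨍ y in meshCube n δ z, w y) - m =
      (δ ^ n)⁻¹ * ∫ y in meshCube n δ z, (w y - m) := by
    rw [setAverage_eq, hvol, integral_sub (integrableOn_meshCube hw δ z)
      (integrableOn_const hfin), setIntegral_const, hvol]
    simp only [smul_eq_mul]
    field_simp
  rw [hm, abs_mul, abs_of_pos (by positivity : 0 < (δ ^ n)⁻¹)]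
  exact mul_le_mul_of_nonneg_left (abs_integral_le_integral_abs) (by positivity)

theorem sum_jumps_le {n : ℕ} {w : EuclideanSpace ℝ (Fin n) → ℝ}
    (hw : LocallyIntegrable w volume) {δ : ℝ} (hδ : 0 < δ) (z : Fin n → ℤ) :
    (∑ i : Fin n, ∑ σ ∈ Finset.univ.filter (fun σ : Fin n → Fin 2 => σ i = 0),
        |(⨍ y in meshCube n δ (childIndex z σ), w y) -
          ⨍ y in meshCube n δ (childIndex z (Function.update σ i 1)), w y|)
      ≤ (n : ℝ) * 2 ^ n *
        ⨍ x in meshCube n (2 * δ) z, |w x - ⨍ y in meshCube n (2 * δ) z, w y| := by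
  set m := ⨍ y in meshCube n (2 * δ) z, w y
  set P := meshCube n (2 * δ) z
  have hPfin : volume P ≠ ∞ := by simp [P, volume_meshCube n (by positivity : 0 < 2 * δ)]
  have hint : IntegrableOn (fun x => |w x - m|) P :=
    ((integrableOn_meshCube hw (2 * δ) z).sub (integrableOn_const hPfin)).abs
  have hsum : ∑ σ, (δ ^ n)⁻¹ * ∫ y in meshCube n δ (childIndex z σ), |w y - m| ≤
      2 ^ n * ⨍ x in P, |w x - m| := by
    rw [← Finset.mul_sum, setAverage_eq, measureReal_def,
      volume_meshCube n (by positivity : 0 < 2 * δ), ENNReal.toReal_ofReal (by positivity),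
      ← integral_iUnion_fintype (fun σ => (isOpen_meshCube n δ _).measurableSet)
        (fun σ τ h => disjoint_meshCube hδ ((childIndex_injective z).ne h))
        (fun σ => hint.mono_set (meshCube_child_subset hδ z σ))]
    have h2 : (2 : ℝ) ^ n * ((2 * δ) ^ n)⁻¹ = (δ ^ n)⁻¹ := by
      rw [mul_pow]; field_simp
    rw [smul_eq_mul, ← mul_assoc, h2]
    refine mul_le_mul_of_nonneg_left ?_ (by positivity)
    exact setIntegral_mono_set hint (ae_of_all _ fun x => abs_nonneg _)
      (Set.iUnion_subset fun σ => meshCube_child_subset hδ z σ).eventuallyLE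
  calc _ ≤ ∑ i : Fin n, ∑ σ : Fin n → Fin 2,
        (δ ^ n)⁻¹ * ∫ y in meshCube n δ (childIndex z σ), |w y - m| := by
        refine Finset.sum_le_sum fun i _ => ?_
        rw [sum_eq_sum_pairs i]
        refine Finset.sum_le_sum fun σ _ => ?_
        refine (abs_sub_le _ m _).trans (add_le_add (abs_average_sub_le hw hδ _ m) ?_)
        rw [abs_sub_comm]
        exact abs_average_sub_le hw hδ _ m
    _ = n * ∑ σ : Fin n → Fin 2,
        (δ ^ n)⁻¹ * ∫ y in meshCube n δ (childIndex z σ), |w y - m| := by simp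
    _ ≤ _ := by
        rw [mul_assoc]
        exact mul_le_mul_of_nonneg_left hsum (by positivity)

/-- The half-open counterpart of `meshCube`, on which `pcn` is constant. -/
def halfOpenCube (n : ℕ) (δ : ℝ) (z : Fin n → ℤ) : Set (EuclideanSpace ℝ (Fin n)) :=
  {x | ∀ i, x i ∈ Set.Ioc (δ * (z i : ℝ)) (δ * ((z i : ℝ) + 1))}

/-- The point of `ℝ^(m+1)` with `i`-th coordinate `t` and remaining coordinates `y`. -/
def insertCoord {m : ℕ} (i : Fin (m + 1)) (t : ℝ) (y : Fin m → ℝ) :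
    EuclideanSpace ℝ (Fin (m + 1)) :=
  WithLp.toLp 2 (i.insertNth t y)

/-- The projection of `halfOpenCube (m + 1) δ z` along the `i`-th direction. -/
def halfOpenFace {m : ℕ} (i : Fin (m + 1)) (δ : ℝ) (z : Fin (m + 1) → ℤ) : Set (Fin m → ℝ) :=
  Set.univ.pi fun j =>
    Set.Ioc (δ * (z (i.succAbove j) : ℝ)) (δ * ((z (i.succAbove j) : ℝ) + 1))

@[simp]
theorem insertCoord_same {m : ℕ} (i : Fin (m + 1)) (t : ℝ) (y : Fin m → ℝ) :
    insertCoord i t y i = t := by simp [insertCoord]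

@[simp]
theorem insertCoord_succAbove {m : ℕ} (i : Fin (m + 1)) (t : ℝ) (y : Fin m → ℝ) (j : Fin m) :
    insertCoord i t y (i.succAbove j) = y j := by simp [insertCoord]

theorem continuous_insertCoord {m : ℕ} (i : Fin (m + 1)) (t : ℝ) :
    Continuous (insertCoord i t) :=
  (PiLp.continuous_toLp 2 _).comp (continuous_const.finInsertNth i continuous_id)

theorem insertCoord_eq_add {m : ℕ} (i : Fin (m + 1)) (t : ℝ) (y : Fin m → ℝ) :
    insertCoord i t y = insertCoord i 0 y + t • EuclideanSpace.single i (1 : ℝ) := by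
  ext k
  induction k using i.succAboveCases <;> simp

theorem hasDerivAt_insertCoord {m : ℕ} (i : Fin (m + 1)) (t : ℝ) (y : Fin m → ℝ) :
    HasDerivAt (fun s => insertCoord i s y) (EuclideanSpace.single i (1 : ℝ)) t := by
  have h := ((hasDerivAt_id t).smul_const (EuclideanSpace.single i (1 : ℝ))).const_add
    (insertCoord i 0 y)
  rw [one_smul] at h
  exact h.congr_of_eventuallyEq (Eventually.of_forall fun s => insertCoord_eq_add i s y)

theorem measurableSet_halfOpenCube (n : ℕ) (δ : ℝ) (z : Fin n → ℤ) :
    MeasurableSet (halfOpenCube n δ z) := by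
  have : halfOpenCube n δ z = WithLp.ofLp ⁻¹'
      Set.univ.pi fun i => Set.Ioc (δ * (z i : ℝ)) (δ * ((z i : ℝ) + 1)) := by
    ext x; simp [halfOpenCube]
  rw [this]
  exact (PiLp.volume_preserving_ofLp (Fin n)).measurable
    (MeasurableSet.univ_pi fun _ => measurableSet_Ioc)

theorem measurableSet_halfOpenFace {m : ℕ} (i : Fin (m + 1)) (δ : ℝ) (z : Fin (m + 1) → ℤ) :
    MeasurableSet (halfOpenFace i δ z) :=
  MeasurableSet.univ_pi fun _ => measurableSet_Ioc

theorem volume_halfOpenFace {m : ℕ} (i : Fin (m + 1)) {δ : ℝ} (hδ : 0 < δ)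
    (z : Fin (m + 1) → ℤ) : volume (halfOpenFace i δ z) = ENNReal.ofReal (δ ^ m) := by
  rw [halfOpenFace, Real.volume_pi_Ioc]
  simp [mul_add, ENNReal.ofReal_pow hδ.le]

/-- Splitting off the `i`-th coordinate of `ℝ^(m+1)`, as a measurable equivalence. -/
def insertCoordEquiv {m : ℕ} (i : Fin (m + 1)) :
    ℝ × (Fin m → ℝ) ≃ᵐ EuclideanSpace ℝ (Fin (m + 1)) :=
  (MeasurableEquiv.piFinSuccAbove (fun _ => ℝ) i).symm.trans (MeasurableEquiv.toLp 2 _)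

theorem insertCoordEquiv_apply {m : ℕ} (i : Fin (m + 1)) (p : ℝ × (Fin m → ℝ)) :
    insertCoordEquiv i p = insertCoord i p.1 p.2 := rfl

theorem measurePreserving_insertCoordEquiv {m : ℕ} (i : Fin (m + 1)) :
    MeasurePreserving (insertCoordEquiv i) :=
  (PiLp.volume_preserving_toLp (Fin (m + 1))).comp
    (volume_preserving_piFinSuccAbove (fun _ : Fin (m + 1) => ℝ) i).symm

theorem insertCoord_mem_halfOpenCube {m : ℕ} (i : Fin (m + 1)) {δ t : ℝ}
    {z : Fin (m + 1) → ℤ} {y : Fin m → ℝ} :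
    insertCoord i t y ∈ halfOpenCube (m + 1) δ z ↔
      t ∈ Set.Ioc (δ * (z i : ℝ)) (δ * ((z i : ℝ) + 1)) ∧ y ∈ halfOpenFace i δ z := by
  simp only [halfOpenCube, Set.mem_ofPred_eq, i.forall_iff_succAbove, insertCoord_same,
    insertCoord_succAbove, halfOpenFace, Set.mem_univ_pi]

theorem integrable_fderiv_apply {n : ℕ} {g : EuclideanSpace ℝ (Fin n) → ℝ}
    (hg : ContDiff ℝ 1 g) (hc : HasCompactSupport g) (v : EuclideanSpace ℝ (Fin n)) :
    Integrable (fun x => fderiv ℝ g x v) :=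
  ((hg.continuous_fderiv one_ne_zero).clm_apply continuous_const).integrable_of_hasCompactSupport
    (hc.fderiv_apply (𝕜 := ℝ) v)

/-- The fundamental theorem of calculus in direction `i` on a half-open cube. -/
theorem setIntegral_fderiv_halfOpenCube {m : ℕ} (i : Fin (m + 1)) {δ : ℝ} (hδ : 0 < δ)
    (a : Fin (m + 1) → ℤ) {g : EuclideanSpace ℝ (Fin (m + 1)) → ℝ}
    (hg : ContDiff ℝ 1 g) (hc : HasCompactSupport g) :
    ∫ x in halfOpenCube (m + 1) δ a, fderiv ℝ g x (EuclideanSpace.single i 1) =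
      ∫ y in halfOpenFace i δ a,
        (g (insertCoord i (δ * ((a i : ℝ) + 1)) y) - g (insertCoord i (δ * (a i : ℝ)) y)) := by
  have hpre : insertCoordEquiv i ⁻¹' halfOpenCube (m + 1) δ a =
      Set.Ioc (δ * (a i : ℝ)) (δ * ((a i : ℝ) + 1)) ×ˢ halfOpenFace i δ a := by
    ext p
    exact insertCoord_mem_halfOpenCube i
  have hmp := measurePreserving_insertCoordEquiv i
  have hint := integrable_fderiv_apply hg hc (EuclideanSpace.single i 1)
  rw [← hmp.setIntegral_preimage_emb (insertCoordEquiv i).measurableEmbedding, hpre,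
    Measure.volume_eq_prod, ← Measure.prod_restrict, integral_prod_symm]
  · refine setIntegral_congr_fun (measurableSet_halfOpenFace i δ a) fun y _ => ?_
    simp only [insertCoordEquiv_apply]
    rw [← intervalIntegral.integral_of_le (by nlinarith)]
    refine intervalIntegral.integral_eq_sub_of_hasDerivAt
      (f := fun t => g (insertCoord i t y)) (fun t _ => ?_) ?_
    · exact ((hg.differentiable one_ne_zero _).hasFDerivAt).comp_hasDerivAt t
        (hasDerivAt_insertCoord i t y)
    · have hcont : Continuous fun t => insertCoord i t y :=
        continuous_iff_continuousAt.2 fun t => (hasDerivAt_insertCoord i t y).continuousAt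
      exact (((hg.continuous_fderiv one_ne_zero).comp hcont).clm_apply
        continuous_const).intervalIntegrable _ _
  · rw [Measure.prod_restrict, ← Measure.volume_eq_prod]
    exact ((hmp.integrable_comp_emb (insertCoordEquiv i).measurableEmbedding).2 hint).integrableOn

theorem pcn_eq_of_mem {n : ℕ} {δ : ℝ} (hδ : 0 < δ) (w : EuclideanSpace ℝ (Fin n) → ℝ)
    {a : Fin n → ℤ} {x : EuclideanSpace ℝ (Fin n)} (hx : x ∈ halfOpenCube n δ a) :
    pcn n δ w x = ⨍ y in meshCube n δ a, w y := by
  have : (fun i => ⌈x i / δ⌉ - 1) = a := by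
    funext i
    have h : ⌈x i / δ⌉ = a i + 1 := by
      rw [Int.ceil_eq_iff, lt_div_iff₀ hδ, div_le_iff₀ hδ]
      have := hx i
      constructor
      · push_cast; linarith [this.1]
      · push_cast; linarith [this.2]
    omega
  rw [pcn, this]

theorem exists_mem_Ioc_child {δ t : ℝ} {a : ℤ}
    (ht : t ∈ Set.Ioo (2 * δ * (a : ℝ)) (2 * δ * ((a : ℝ) + 1))) :
    ∃ s : Fin 2, t ∈ Set.Ioc (δ * ((2 * a + ((s : ℕ) : ℤ) : ℤ) : ℝ))
      (δ * (((2 * a + ((s : ℕ) : ℤ) : ℤ) : ℝ) + 1)) := by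
  rcases le_or_gt t (δ * (2 * a + 1)) with h | h
  · exact ⟨0, by push_cast; constructor <;> simp <;> linarith [ht.1]⟩
  · exact ⟨1, by push_cast; constructor <;> simp <;> linarith [ht.2]⟩

theorem exists_mem_halfOpenCube {n : ℕ} {δ : ℝ} {z : Fin n → ℤ}
    {x : EuclideanSpace ℝ (Fin n)} (hx : x ∈ meshCube n (2 * δ) z) :
    ∃ σ, x ∈ halfOpenCube n δ (childIndex z σ) := by
  choose σ hσ using fun i => exists_mem_Ioc_child (hx i)
  exact ⟨σ, hσ⟩

/-- `pcn` times a function supported in a cube of the `2δ`-mesh, as a sum over subcubes. -/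
theorem pcn_mul_eq_sum {n : ℕ} {δ : ℝ} (hδ : 0 < δ) (w : EuclideanSpace ℝ (Fin n) → ℝ)
    (z : Fin n → ℤ) {h : EuclideanSpace ℝ (Fin n) → ℝ}
    (hh : ∀ x ∉ meshCube n (2 * δ) z, h x = 0) (x : EuclideanSpace ℝ (Fin n)) :
    pcn n δ w x * h x = ∑ σ, (⨍ y in meshCube n δ (childIndex z σ), w y) *
      (halfOpenCube n δ (childIndex z σ)).indicator h x := by
  by_cases hx : x ∈ meshCube n (2 * δ) z
  · obtain ⟨σ, hσ⟩ := exists_mem_halfOpenCube hx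
    rw [Finset.sum_eq_single σ]
    · rw [Set.indicator_of_mem hσ, pcn_eq_of_mem hδ w hσ]
    · intro τ _ hτ
      rw [Set.indicator_of_notMem, mul_zero]
      exact fun hxτ => hτ <| childIndex_injective z <| funext fun i =>
        mesh_index_unique hδ (hxτ i) (hσ i)
    · simp
  · rw [hh x hx, mul_zero, Finset.sum_eq_zero]
    intro σ _
    rw [Set.indicator_apply_eq_zero.2 fun _ => hh x hx, mul_zero]

theorem fderiv_apply_eq_zero_of_notMem {n : ℕ} {g : EuclideanSpace ℝ (Fin n) → ℝ}
    {U : Set (EuclideanSpace ℝ (Fin n))} (hU : tsupport g ⊆ U) (v : EuclideanSpace ℝ (Fin n)) :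
    ∀ x ∉ U, fderiv ℝ g x v = 0 := by
  intro x hx
  have : fderiv ℝ g x = 0 := by
    by_contra h
    exact hx (hU (support_fderiv_subset ℝ h))
  simp [this]

theorem integrable_pcn_mul_fderiv {n : ℕ} {δ : ℝ} (hδ : 0 < δ)
    (w : EuclideanSpace ℝ (Fin n) → ℝ) (z : Fin n → ℤ)
    {g : EuclideanSpace ℝ (Fin n) → ℝ} (hg : ContDiff ℝ 1 g) (hc : HasCompactSupport g)
    (hs : tsupport g ⊆ meshCube n (2 * δ) z) (v : EuclideanSpace ℝ (Fin n)) :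
    Integrable (fun x => pcn n δ w x * fderiv ℝ g x v) := by
  simp_rw [pcn_mul_eq_sum hδ w z (fderiv_apply_eq_zero_of_notMem hs v)]
  exact integrable_finsetSum _ fun σ _ =>
    ((integrable_fderiv_apply hg hc v).indicator (measurableSet_halfOpenCube _ _ _)).const_mul _

/-- Integration by parts in direction `i` for `pcn`: only the inner faces contribute. -/
theorem integral_pcn_mul_fderiv {m : ℕ} {δ : ℝ} (hδ : 0 < δ)
    (w : EuclideanSpace ℝ (Fin (m + 1)) → ℝ) (z : Fin (m + 1) → ℤ) (i : Fin (m + 1))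
    {g : EuclideanSpace ℝ (Fin (m + 1)) → ℝ} (hg : ContDiff ℝ 1 g) (hc : HasCompactSupport g)
    (hs : tsupport g ⊆ meshCube (m + 1) (2 * δ) z) :
    ∫ x, pcn (m + 1) δ w x * fderiv ℝ g x (EuclideanSpace.single i 1) =
      ∑ σ ∈ Finset.univ.filter (fun σ : Fin (m + 1) → Fin 2 => σ i = 0),
        ((⨍ y in meshCube (m + 1) δ (childIndex z σ), w y) -
          ⨍ y in meshCube (m + 1) δ (childIndex z (Function.update σ i 1)), w y) *
        ∫ y in halfOpenFace i δ (childIndex z σ), g (insertCoord i (δ * (2 * z i + 1)) y) := by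
  have hzero : ∀ t y, t ∉ Set.Ioo (2 * δ * (z i : ℝ)) (2 * δ * ((z i : ℝ) + 1)) →
      g (insertCoord i t y) = 0 := fun t y ht =>
    image_eq_zero_of_notMem_tsupport fun h => ht (by simpa using hs h i)
  simp_rw [pcn_mul_eq_sum hδ w z (fderiv_apply_eq_zero_of_notMem hs _)]
  rw [integral_finsetSum _ fun σ _ => ((integrable_fderiv_apply hg hc _).indicator
    (measurableSet_halfOpenCube _ _ _)).const_mul _, sum_eq_sum_pairs i]
  refine Finset.sum_congr rfl fun σ hσ => ?_
  replace hσ : σ i = 0 := by simpa using hσ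
  have hface : halfOpenFace i δ (childIndex z (Function.update σ i 1)) =
      halfOpenFace i δ (childIndex z σ) := by
    simp [halfOpenFace, childIndex]
  simp_rw [integral_const_mul, integral_indicator (measurableSet_halfOpenCube _ _ _),
    setIntegral_fderiv_halfOpenCube i hδ _ hg hc, hface]
  have e0 : δ * ((childIndex z σ i : ℤ) : ℝ) = 2 * δ * z i := by
    simp [childIndex, hσ]; ring
  have e1 : δ * (((childIndex z σ i : ℤ) : ℝ) + 1) = δ * (2 * z i + 1) := by
    simp [childIndex, hσ]
  have e2 : δ * ((childIndex z (Function.update σ i 1) i : ℤ) : ℝ) = δ * (2 * z i + 1) := by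
    simp [childIndex]
  have e3 : δ * (((childIndex z (Function.update σ i 1) i : ℤ) : ℝ) + 1) =
      2 * δ * (z i + 1) := by
    simp [childIndex]; ring
  simp_rw [e0, e1, e2, e3, hzero (2 * δ * z i) _ (by simp),
    hzero (2 * δ * (z i + 1)) _ (by simp), sub_zero, zero_sub, integral_neg]
  ring

/-- The divergence theorem for `pcn` against a vector field supported in a `2δ`-cube. -/
theorem integral_pcn_mul_div' {m : ℕ} {δ : ℝ} (hδ : 0 < δ)
    (w : EuclideanSpace ℝ (Fin (m + 1)) → ℝ) (z : Fin (m + 1) → ℤ)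
    {φ : EuclideanSpace ℝ (Fin (m + 1)) → EuclideanSpace ℝ (Fin (m + 1))}
    (hφ : ContDiff ℝ 1 φ) (hc : HasCompactSupport φ)
    (hs : tsupport φ ⊆ meshCube (m + 1) (2 * δ) z) :
    ∫ x, pcn (m + 1) δ w x * div' φ x =
      ∑ i, ∑ σ ∈ Finset.univ.filter (fun σ : Fin (m + 1) → Fin 2 => σ i = 0),
        ((⨍ y in meshCube (m + 1) δ (childIndex z σ), w y) -
          ⨍ y in meshCube (m + 1) δ (childIndex z (Function.update σ i 1)), w y) *
        ∫ y in halfOpenFace i δ (childIndex z σ), φ (insertCoord i (δ * (2 * z i + 1)) y) i := by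
  have hg : ∀ i, ContDiff ℝ 1 fun x => φ x i := fun i => (contDiff_piLp 2).1 hφ i
  have hsub : ∀ i, tsupport (fun x => φ x i) ⊆ tsupport φ := fun i =>
    closure_mono fun x hx h => hx (by simp [h])
  have hcg : ∀ i, HasCompactSupport fun x => φ x i := fun i =>
    hc.mono' ((subset_tsupport _).trans (hsub i))
  have hdiv : ∀ x i, fderiv ℝ φ x (EuclideanSpace.single i 1) i =
      fderiv ℝ (fun x => φ x i) x (EuclideanSpace.single i 1) := fun x i => by
    have h := (PiLp.proj 2 (𝕜 := ℝ) (fun _ : Fin (m + 1) => ℝ) i).hasFDerivAt.comp x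
      (hφ.differentiable one_ne_zero x).hasFDerivAt
    have h' : fderiv ℝ (fun x => φ x i) x = _ := h.fderiv
    rw [h']; rfl
  simp_rw [div', Finset.mul_sum, hdiv]
  rw [integral_finsetSum _ fun i _ => integrable_pcn_mul_fderiv hδ w z (hg i) (hcg i)
    ((hsub i).trans hs) _]
  exact Finset.sum_congr rfl fun i _ =>
    integral_pcn_mul_fderiv hδ w z i (hg i) (hcg i) ((hsub i).trans hs)

/-- A neighbourhood of the open inner face of `meshCube n (2 * δ) z` orthogonal to direction `i`
with position `σ`; these are pairwise disjoint for distinct faces. -/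
def faceNhd {n : ℕ} (δ : ℝ) (z : Fin n → ℤ) (i : Fin n) (σ : Fin n → Fin 2) :
    Set (EuclideanSpace ℝ (Fin n)) :=
  meshCube n (2 * δ) z ∩ ⋂ j : {j // j ≠ i},
    {x | |x i - δ * (2 * z i + 1)| < |x j - δ * (2 * z j + 1)|} ∩
      {x | x j ∈ Set.Ioo (δ * (childIndex z σ j : ℝ)) (δ * ((childIndex z σ j : ℝ) + 1))}

theorem isOpen_faceNhd {n : ℕ} (δ : ℝ) (z : Fin n → ℤ) (i : Fin n) (σ : Fin n → Fin 2) :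
    IsOpen (faceNhd δ z i σ) := by
  have hproj : ∀ k, Continuous fun x : EuclideanSpace ℝ (Fin n) => x k := fun k => by fun_prop
  refine (isOpen_meshCube _ _ _).inter (isOpen_iInter_of_finite fun j => ?_)
  exact (isOpen_lt (by fun_prop) (by fun_prop)).inter (isOpen_Ioo.preimage (hproj j))

theorem eq_of_mem_faceNhd {n : ℕ} {δ : ℝ} (hδ : 0 < δ) {z : Fin n → ℤ} {i k : Fin n}
    {σ τ : Fin n → Fin 2} (hσ : σ i = 0) (hτ : τ k = 0) {x : EuclideanSpace ℝ (Fin n)}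
    (hx : x ∈ faceNhd δ z i σ) (hx' : x ∈ faceNhd δ z k τ) : i = k ∧ σ = τ := by
  have h := fun j => Set.mem_iInter.1 hx.2 j
  have h' := fun j => Set.mem_iInter.1 hx'.2 j
  have hik : i = k := by
    by_contra hne
    have h1 : |x i - _| < |x k - _| := (h ⟨k, Ne.symm hne⟩).1
    have h2 : |x k - _| < |x i - _| := (h' ⟨i, hne⟩).1
    exact lt_asymm h1 h2
  subst hik
  refine ⟨rfl, funext fun j => ?_⟩
  by_cases hj : j = i
  · rw [hj, hσ, hτ]
  · have := mesh_index_unique hδ (Set.Ioo_subset_Ioc_self (h ⟨j, hj⟩).2)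
      (Set.Ioo_subset_Ioc_self (h' ⟨j, hj⟩).2)
    simp only [childIndex] at this
    exact Fin.ext (by omega)

theorem eq_of_insertCoord_mem_faceNhd {m : ℕ} {δ t : ℝ} (hδ : 0 < δ) {z : Fin (m + 1) → ℤ}
    {i : Fin (m + 1)} {σ τ : Fin (m + 1) → Fin 2} (hσ : σ i = 0) (hτ : τ i = 0) {y : Fin m → ℝ}
    (hy : y ∈ halfOpenFace i δ (childIndex z σ)) (hy' : insertCoord i t y ∈ faceNhd δ z i τ) :
    τ = σ := by
  funext j
  induction j using i.succAboveCases with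
  | x => rw [hσ, hτ]
  | p j =>
    have h := (Set.mem_iInter.1 hy'.2 ⟨i.succAbove j, Fin.succAbove_ne _ _⟩).2
    simp only [Set.mem_ofPred_eq, insertCoord_succAbove] at h
    have := mesh_index_unique hδ (Set.Ioo_subset_Ioc_self h) (hy j (Set.mem_univ j))
    simp only [childIndex] at this
    exact Fin.ext (by omega)

/-- A cutoff function supported near an inner face whose integral over that face is close to
the full area. -/
theorem exists_face_cutoff {m : ℕ} {δ r : ℝ} (hδ : 0 < δ) (hr : r < δ ^ m)
    (z : Fin (m + 1) → ℤ) (i : Fin (m + 1)) (σ : Fin (m + 1) → Fin 2) :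
    ∃ η : EuclideanSpace ℝ (Fin (m + 1)) → ℝ, ContDiff ℝ 1 η ∧ HasCompactSupport η ∧
      tsupport η ⊆ faceNhd δ z i σ ∧ (∀ x, η x ∈ Set.Icc (0 : ℝ) 1) ∧
      r ≤ ∫ y in halfOpenFace i δ (childIndex z σ), η (insertCoord i (δ * (2 * z i + 1)) y) := by
  set V : Set (Fin m → ℝ) := Set.univ.pi fun j =>
    Set.Ioo (δ * (childIndex z σ (i.succAbove j) : ℝ))
      (δ * ((childIndex z σ (i.succAbove j) : ℝ) + 1)) with hV
  have hVopen : IsOpen V := isOpen_set_pi Set.finite_univ fun _ _ => isOpen_Ioo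
  have hVvol : volume V = ENNReal.ofReal (δ ^ m) := by
    rw [hV, Real.volume_pi_Ioo]
    simp [mul_add, ENNReal.ofReal_pow hδ.le]
  have hVF : V ⊆ halfOpenFace i δ (childIndex z σ) :=
    Set.pi_mono fun _ _ => Set.Ioo_subset_Ioc_self
  obtain ⟨K, hKV, hK, hrK⟩ := hVopen.exists_lt_isCompact (μ := volume) (r := ENNReal.ofReal r)
    (by rw [hVvol]; exact (ENNReal.ofReal_lt_ofReal_iff (by positivity)).2 hr)
  set c := δ * (2 * (z i : ℝ) + 1) with hc
  have hKU : insertCoord i c '' K ⊆ faceNhd δ z i σ := by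
    rintro _ ⟨y, hy, rfl⟩
    have hyV : ∀ j, y j ∈ Set.Ioo (δ * (childIndex z σ (i.succAbove j) : ℝ))
      (δ * ((childIndex z σ (i.succAbove j) : ℝ) + 1)) := fun j => hKV hy j (Set.mem_univ j)
    refine ⟨?_, Set.mem_iInter.2 ?_⟩
    · refine i.forall_iff_succAbove.2 ⟨?_, fun j => ?_⟩
      · rw [insertCoord_same]
        constructor <;> nlinarith
      · rw [insertCoord_succAbove]
        exact Ioo_child_subset hδ _ _ (hyV j)
    · rintro ⟨j, hj⟩
      obtain ⟨j, rfl⟩ := Fin.exists_succAbove_eq hj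
      refine ⟨?_, by simpa using hyV j⟩
      simp only [Set.mem_ofPred_eq, insertCoord_same, insertCoord_succAbove, ← hc, sub_self,
        abs_zero, abs_pos]
      intro h0
      have hyj := hyV j
      rw [sub_eq_zero.1 h0] at hyj
      have h1 := lt_of_mul_lt_mul_left hyj.1 hδ.le
      have h2 := lt_of_mul_lt_mul_left hyj.2 hδ.le
      have h3 : childIndex z σ (i.succAbove j) < 2 * z (i.succAbove j) + 1 := by exact_mod_cast h1
      have h4 : 2 * z (i.succAbove j) + 1 < childIndex z σ (i.succAbove j) + 1 := by
        exact_mod_cast h2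
      omega
  obtain ⟨t, ht, hKt, htU⟩ := exists_compact_between
    (hK.image (continuous_insertCoord i c)) (isOpen_faceNhd δ z i σ) hKU
  obtain ⟨f, hf1, hf0, hf⟩ := exists_contMDiffMap_one_nhds_of_subset_interior
    (n := 1) (modelWithCornersSelf ℝ (EuclideanSpace ℝ (Fin (m + 1))))
    (hK.image (continuous_insertCoord i c)).isClosed hKt
  have hsupp : Function.support f ⊆ t := fun x hx => by
    by_contra h
    exact hx (hf0 x h)
  refine ⟨f, f.contMDiff.contDiff, HasCompactSupport.of_support_subset_isCompact ht hsupp,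
    (closure_minimal hsupp ht.isClosed).trans htU, hf, ?_⟩
  have hFfin : volume (halfOpenFace i δ (childIndex z σ)) ≠ ∞ := by
    simp [volume_halfOpenFace i hδ]
  have hint : IntegrableOn (fun y => f (insertCoord i c y))
      (halfOpenFace i δ (childIndex z σ)) := by
    refine Measure.integrableOn_of_bounded (M := 1) hFfin
      (f.contMDiff.continuous.comp (continuous_insertCoord i c)).aestronglyMeasurable
      (ae_of_all _ fun y => ?_)
    rw [Real.norm_of_nonneg (hf _).1]
    exact (hf _).2
  calc r ≤ volume.real K := by
        rw [measureReal_def]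
        exact (ENNReal.ofReal_le_iff_le_toReal hK.measure_lt_top.ne).1 hrK.le
    _ = ∫ y in K, f (insertCoord i c y) := by
        rw [setIntegral_congr_fun (g := fun _ => (1 : ℝ)) hK.measurableSet fun y hy =>
          hf1.self_of_nhdsSet _ (Set.mem_image_of_mem _ hy)]
        simp
    _ ≤ _ := setIntegral_mono_set hint (ae_of_all _ fun y => (hf _).1)
        (hKV.trans hVF).eventuallyLE

/-- A vector field whose `i`-th component has values `s i σ` on most of the inner face
`(i, σ)`. -/
theorem exists_face_field {m : ℕ} {δ r : ℝ} (hδ : 0 < δ) (hr : r < δ ^ m)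
    (z : Fin (m + 1) → ℤ) (s : Fin (m + 1) → (Fin (m + 1) → Fin 2) → ℝ)
    (hs : ∀ i σ, |s i σ| ≤ 1) :
    ∃ φ : EuclideanSpace ℝ (Fin (m + 1)) → EuclideanSpace ℝ (Fin (m + 1)),
      ContDiff ℝ 1 φ ∧ HasCompactSupport φ ∧ tsupport φ ⊆ meshCube (m + 1) (2 * δ) z ∧
      (∀ x, ‖φ x‖ ≤ 1) ∧ ∀ i σ, σ i = 0 → ∃ q, r ≤ q ∧
        ∫ y in halfOpenFace i δ (childIndex z σ), φ (insertCoord i (δ * (2 * z i + 1)) y) i =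
          s i σ * q := by
  choose η hη hηc hηs hη01 hηr using exists_face_cutoff hδ hr z
  set φ : EuclideanSpace ℝ (Fin (m + 1)) → EuclideanSpace ℝ (Fin (m + 1)) := fun x =>
    WithLp.toLp 2 fun i => ∑ σ ∈ Finset.univ.filter
      (fun σ : Fin (m + 1) → Fin 2 => σ i = 0), s i σ * η i σ x with hφ
  have hmem : ∀ {i σ x}, η i σ x ≠ 0 → x ∈ faceNhd δ z i σ := fun h =>
    hηs _ _ (subset_tsupport _ h)
  have hT : IsCompact (⋃ p : Fin (m + 1) × (Fin (m + 1) → Fin 2), tsupport (η p.1 p.2)) :=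
    isCompact_iUnion fun p => hηc p.1 p.2
  have hsupp : Function.support φ ⊆
      ⋃ p : Fin (m + 1) × (Fin (m + 1) → Fin 2), tsupport (η p.1 p.2) := by
    intro x hx
    by_contra h
    refine hx ?_
    have h0 : ∀ i σ, η i σ x = 0 := fun i σ => by
      by_contra hne
      exact h (Set.mem_iUnion.2 ⟨(i, σ), subset_tsupport _ hne⟩)
    ext i
    simp [hφ, h0]
  refine ⟨φ, ?_, HasCompactSupport.of_support_subset_isCompact hT hsupp,
    (closure_minimal hsupp hT.isClosed).trans
      (Set.iUnion_subset fun p => (hηs p.1 p.2).trans Set.inter_subset_left), fun x => ?_,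
    fun i σ hσ => ⟨_, hηr i σ, ?_⟩⟩
  · refine (contDiff_piLp 2).2 fun i => ?_
    exact ContDiff.sum fun σ _ => contDiff_const.mul (hη i σ)
  · by_cases h : ∃ i σ, σ i = 0 ∧ η i σ x ≠ 0
    · obtain ⟨i, σ, hσ, hne⟩ := h
      have hz : ∀ k τ, τ k = 0 → (i = k → σ ≠ τ) → η k τ x = 0 := fun k τ hτ hkτ => by
        by_contra hne'
        obtain ⟨h1, h2⟩ := eq_of_mem_faceNhd hδ hσ hτ (hmem hne) (hmem hne')
        exact hkτ h1 h2
      have hx : φ x = EuclideanSpace.single i (s i σ * η i σ x) := by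
        ext k
        by_cases hk : k = i
        · subst hk
          simp only [hφ, PiLp.single_apply, if_true]
          refine Finset.sum_eq_single σ (fun τ hτ hne => ?_) (by simp [hσ])
          rw [hz k τ (by simpa using hτ) fun _ => hne.symm, mul_zero]
        · simp only [hφ, PiLp.single_apply, if_neg hk]
          refine Finset.sum_eq_zero fun τ hτ => ?_
          rw [hz k τ (by simpa using hτ) fun h => absurd h.symm hk, mul_zero]
      rw [hx, PiLp.norm_single, Real.norm_eq_abs, abs_mul, abs_of_nonneg (hη01 i σ x).1]
      exact mul_le_one₀ (hs i σ) (hη01 i σ x).1 (hη01 i σ x).2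
    · push Not at h
      have hx : φ x = 0 := by
        ext k
        exact Finset.sum_eq_zero fun τ hτ => by rw [h k τ (by simpa using hτ), mul_zero]
      simp [hx]
  · rw [← integral_const_mul]
    refine setIntegral_congr_fun (measurableSet_halfOpenFace _ _ _) fun y hy => ?_
    refine Finset.sum_eq_single σ (fun τ hτ hne => ?_) (by simp [hσ])
    by_contra h
    exact hne (eq_of_insertCoord_mem_faceNhd hδ hσ (by simpa using hτ) hy
      (hmem (right_ne_zero_of_mul h)))

/-- The total variation of `pcn` on a cube of the `2δ`-mesh is the sum of its jumps over the
inner faces, weighted by their area. -/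
theorem totalVariationOn_pcn {m : ℕ} {δ : ℝ} (hδ : 0 < δ)
    (w : EuclideanSpace ℝ (Fin (m + 1)) → ℝ) (z : Fin (m + 1) → ℤ) :
    totalVariationOn (m + 1) (pcn (m + 1) δ w) (meshCube (m + 1) (2 * δ) z) =
      ENNReal.ofReal (δ ^ m *
        ∑ i, ∑ σ ∈ Finset.univ.filter (fun σ : Fin (m + 1) → Fin 2 => σ i = 0),
          |(⨍ y in meshCube (m + 1) δ (childIndex z σ), w y) -
            ⨍ y in meshCube (m + 1) δ (childIndex z (Function.update σ i 1)), w y|) := by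
  set J : Fin (m + 1) → (Fin (m + 1) → Fin 2) → ℝ := fun i σ =>
    (⨍ y in meshCube (m + 1) δ (childIndex z σ), w y) -
      ⨍ y in meshCube (m + 1) δ (childIndex z (Function.update σ i 1)), w y
  change _ = ENNReal.ofReal (δ ^ m * ∑ i, ∑ σ ∈ _, |J i σ|)
  refine le_antisymm ?_ ?_
  · refine iSup_le fun φ => iSup_le fun hφ => iSup_le fun hc => iSup_le fun hs =>
      iSup_le fun h1 => ENNReal.ofReal_le_ofReal ?_
    rw [integral_pcn_mul_div' hδ w z hφ hc hs]
    simp_rw [Finset.mul_sum]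
    refine Finset.sum_le_sum fun i _ => Finset.sum_le_sum fun σ _ => ?_
    have hF : |∫ y in halfOpenFace i δ (childIndex z σ),
        φ (insertCoord i (δ * (2 * z i + 1)) y) i| ≤ δ ^ m := by
      have := norm_setIntegral_le_of_norm_le_const (μ := volume) (C := 1)
        (s := halfOpenFace i δ (childIndex z σ))
        (f := fun y => φ (insertCoord i (δ * (2 * z i + 1)) y) i)
        (by simp [volume_halfOpenFace i hδ])
        (fun y _ => (PiLp.norm_apply_le _ i).trans (h1 _))
      rwa [Real.norm_eq_abs, one_mul, measureReal_def, volume_halfOpenFace i hδ,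
        ENNReal.toReal_ofReal (by positivity)] at this
    calc J i σ * _ ≤ |J i σ * _| := le_abs_self _
      _ ≤ |J i σ| * δ ^ m := by
        rw [abs_mul]
        exact mul_le_mul_of_nonneg_left hF (abs_nonneg _)
      _ = _ := mul_comm _ _
  · have htend : Tendsto (fun r : ℝ => ENNReal.ofReal (r * ∑ i, ∑ σ ∈ Finset.univ.filter
        (fun σ : Fin (m + 1) → Fin 2 => σ i = 0), |J i σ|)) (𝓝[<] (δ ^ m))
        (𝓝 (ENNReal.ofReal (δ ^ m * ∑ i, ∑ σ ∈ Finset.univ.filter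
        (fun σ : Fin (m + 1) → Fin 2 => σ i = 0), |J i σ|))) :=
      (ENNReal.continuous_ofReal.comp (continuous_id.mul continuous_const)).continuousAt.mono_left
        nhdsWithin_le_nhds
    refine le_of_tendsto htend (eventually_mem_nhdsWithin.mono fun r hr => ?_)
    obtain ⟨φ, hφ, hc, hs, h1, hq⟩ := exists_face_field hδ hr z
      (fun i σ => (SignType.sign (J i σ) : ℝ)) fun i σ => by
        rcases lt_trichotomy (J i σ) 0 with h | h | h <;> simp [h]
    refine le_trans ?_ (le_iSup_of_le φ <| le_iSup_of_le hφ <| le_iSup_of_le hc <|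
      le_iSup_of_le hs <| le_iSup_of_le h1 le_rfl)
    refine ENNReal.ofReal_le_ofReal ?_
    rw [integral_pcn_mul_div' hδ w z hφ hc hs]
    simp_rw [Finset.mul_sum]
    refine Finset.sum_le_sum fun i _ => Finset.sum_le_sum fun σ hσ => ?_
    obtain ⟨q, hrq, hq⟩ := hq i σ (by simpa using hσ)
    rw [hq, ← mul_assoc, self_mul_sign, mul_comm]
    exact mul_le_mul_of_nonneg_left hrq (abs_nonneg _)

/-- For `P ∈ Q_{2δ}`: summing the jumps `|w_Q - w_{Q'}|` over all unordered pairs of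
neighbouring `δ`-subcubes of `P` (indexed by a direction `i` and `σ : {0,1}^n` with `σ i = 0`,
paired with `σ` flipped at `i`), one gets at most `n·2^n ⨍_P |w - ⨍_P w|`; consequently
`|Dw^δ|(P) = δ^{n-1} Σ |w_Q - w_{Q'}| ≤ 2n·(2δ)^{n-1}·⨍_P |w - ⨍_P w|`. -/
theorem stmt15 (n : ℕ) (hn : 1 ≤ n) (w : EuclideanSpace ℝ (Fin n) → ℝ)
    (hw : LocallyIntegrable w volume) (δ : ℝ) (hδ : 0 < δ) (z : Fin n → ℤ) :
    (∑ i : Fin n, ∑ σ ∈ Finset.univ.filter (fun σ : Fin n → Fin 2 => σ i = 0),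
        |(⨍ y in meshCube n δ (fun j => 2 * z j + ((σ j : ℕ) : ℤ)), w y) -
          ⨍ y in meshCube n δ (fun j => 2 * z j + ((Function.update σ i 1 j : ℕ) : ℤ)), w y|)
      ≤ (n : ℝ) * 2 ^ n *
        ⨍ x in meshCube n (2 * δ) z, |w x - ⨍ y in meshCube n (2 * δ) z, w y| ∧
    totalVariationOn n (pcn n δ w) (meshCube n (2 * δ) z) =
      ENNReal.ofReal (δ ^ (n - 1) *
        ∑ i : Fin n, ∑ σ ∈ Finset.univ.filter (fun σ : Fin n → Fin 2 => σ i = 0),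
          |(⨍ y in meshCube n δ (fun j => 2 * z j + ((σ j : ℕ) : ℤ)), w y) -
            ⨍ y in meshCube n δ (fun j => 2 * z j + ((Function.update σ i 1 j : ℕ) : ℤ)), w y|) ∧
    totalVariationOn n (pcn n δ w) (meshCube n (2 * δ) z) ≤
      ENNReal.ofReal (2 * n * (2 * δ) ^ (n - 1) *
        ⨍ x in meshCube n (2 * δ) z, |w x - ⨍ y in meshCube n (2 * δ) z, w y|) := by
  obtain ⟨m, rfl⟩ : ∃ m, n = m + 1 := ⟨n - 1, by omega⟩
  have hsum := sum_jumps_le hw hδ z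
  have htv := totalVariationOn_pcn hδ w z
  refine ⟨hsum, htv, htv.trans_le (ENNReal.ofReal_le_ofReal ?_)⟩
  refine (mul_le_mul_of_nonneg_left hsum (by positivity)).trans_eq ?_
  rw [Nat.add_sub_cancel, mul_pow, pow_succ]
  ring
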